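/- Let n = 2ℓ + 2 or n = ℓ + 1, and let P_ℓ(S_n) ⊆ R = k[x_1,...,x_n] be the path ideal of the path graph on n vertices. Then R/P_ℓ(S_n) is Cohen-Macaulay, i.e., depth(R/P_ℓ(S_n)) = dim(R/P_ℓ(S_n)). Moreover, for ℓ+1 < n < 2ℓ+2, depth(R/P_ℓ(S_n)) = n-2 while dim(R/P_ℓ(S_n)) = n-1, so R/P_ℓ(S_n) is not Cohen-Macaulay. -/

import Mathlib

/-- The path ideal `P_ℓ(S_n)` of the path graph (spine) on `n` vertices:
the ideal of `k[x_1,…,x_n]` generated by the products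
`x_i x_{i+1} ⋯ x_{i+ℓ}` of `ℓ+1` consecutive variables (0-based indexing). -/
noncomputable def spinePathIdeal (k : Type*) [Field k] (n ℓ : ℕ) :
    Ideal (MvPolynomial (Fin n) k) :=
  Ideal.span (Set.image (fun i : ℕ => ∏ v ∈ Finset.univ.filter
      (fun v : Fin n => i ≤ (v : ℕ) ∧ (v : ℕ) ≤ i + ℓ), MvPolynomial.X v)
    {i : ℕ | i + ℓ < n})

/-- The depth of `R/I` with respect to the maximal homogeneous ideal of the
polynomial ring `R = k[x_1,…,x_n]`: the largest length of a regular sequence on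
`R/I` consisting of elements of the irrelevant maximal ideal. -/
noncomputable def quotientDepth (k : Type*) [Field k] {n : ℕ}
    (I : Ideal (MvPolynomial (Fin n) k)) : ℕ :=
  sSup {d | ∃ rs : List (MvPolynomial (Fin n) k), rs.length = d ∧
    (∀ r ∈ rs, r ∈ Ideal.span
      (Set.range (MvPolynomial.X : Fin n → MvPolynomial (Fin n) k))) ∧
    RingTheory.Sequence.IsRegular (MvPolynomial (Fin n) k ⧸ I) rs}

/-- Ideal-theoretic form of weak regularity of a list on the quotient `R ⧸ I`. -/
def WReg {R : Type*} [CommRing R] : Ideal R → List R → Prop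
  | _, [] => True
  | I, r :: rs => (∀ g, r * g ∈ I → g ∈ I) ∧ WReg (I ⊔ Ideal.span {r}) rs

open scoped Pointwise in
theorem isWeaklyRegular_iff_wReg {R : Type*} [CommRing R] (I : Ideal R) (rs : List R) :
    RingTheory.Sequence.IsWeaklyRegular (R ⧸ I) rs ↔ WReg I rs := by
  induction rs generalizing I with
  | nil => simp [WReg]
  | cons r rs ih =>
    rw [RingTheory.Sequence.isWeaklyRegular_cons_iff, WReg, ← ih]
    refine and_congr ?_ ?_
    · exact isSMulRegular_quotient_iff_mem_of_smul_mem I r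
    · have h : (r • (⊤ : Submodule R (R ⧸ I))) = Submodule.map I.mkQ (Ideal.span {r}) := by
        ext x
        obtain ⟨y, rfl⟩ := Submodule.mkQ_surjective I x
        constructor
        · intro hx
          obtain ⟨z, -, hz⟩ := Submodule.mem_smul_pointwise_iff_exists _ _ _ |>.mp hx
          obtain ⟨w, rfl⟩ := Submodule.mkQ_surjective I z
          exact ⟨r * w, Ideal.mem_span_singleton.mpr ⟨w, rfl⟩, hz⟩
        · rintro ⟨z, hz, hzy⟩
          obtain ⟨w, rfl⟩ := Ideal.mem_span_singleton.mp hz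
          rw [← hzy]
          exact Submodule.mem_smul_pointwise_iff_exists _ _ _ |>.mpr ⟨I.mkQ w, trivial, rfl⟩
      exact ((Submodule.quotEquivOfEq _ _ h).trans
        (Submodule.quotientQuotientEquivQuotientSup I (Ideal.span {r}))).isWeaklyRegular_congr rs

theorem WReg.of_colon {R : Type*} [CommRing R] {f : R} (rs : List R) {I C D : Ideal R}
    (hC : ∀ g, g ∈ C ↔ f * g ∈ I) (hD : D = I ⊔ Ideal.span {f})
    (h1 : WReg C rs) (h2 : WReg D rs) : WReg I rs := by
  induction rs generalizing I C D with
  | nil => trivial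
  | cons r rs ih =>
    have hmem : ∀ (J : Ideal R) (a x : R), x ∈ J ⊔ Ideal.span {a} ↔ ∃ i ∈ J, ∃ h, x = i + a * h := by
      intro J a x
      rw [Submodule.mem_sup]
      constructor
      · rintro ⟨y, hy, z, hz, rfl⟩
        obtain ⟨w, rfl⟩ := Ideal.mem_span_singleton.mp hz
        exact ⟨y, hy, w, rfl⟩
      · rintro ⟨i, hi, h, rfl⟩
        exact ⟨i, hi, a * h, Ideal.mem_span_singleton.mpr ⟨h, rfl⟩, rfl⟩
    obtain ⟨c1, c2⟩ := h1
    obtain ⟨d1, d2⟩ := h2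
    refine ⟨?_, ih (C := C ⊔ Ideal.span {r}) (D := D ⊔ Ideal.span {r}) ?_ ?_ c2 d2⟩
    · intro g hg
      have : g ∈ D := d1 g (by rw [hD]; exact Ideal.mem_sup_left hg)
      rw [hD, hmem] at this
      obtain ⟨i, hi, h, rfl⟩ := this
      refine I.add_mem hi ((hC h).mp (c1 h ((hC _).mpr ?_)))
      have : f * (r * h) = r * (i + f * h) - r * i := by ring
      rw [this]
      exact I.sub_mem hg (I.mul_mem_left _ hi)
    · intro g
      rw [hmem, hmem]
      constructor
      · rintro ⟨c, hc, h, rfl⟩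
        exact ⟨f * c, (hC c).mp hc, f * h, by ring⟩
      · rintro ⟨i, hi, h, e⟩
        have : h ∈ D := d1 h (by
          rw [hD, hmem]
          exact ⟨-i, I.neg_mem hi, g, by rw [e]; ring⟩)
        rw [hD, hmem] at this
        obtain ⟨j, hj, h', rfl⟩ := this
        refine ⟨g - r * h', (hC _).mpr ?_, h', by ring⟩
        have : f * (g - r * h') = i + r * j := by rw [mul_sub, e]; ring
        rw [this]
        exact I.add_mem hi (I.mul_mem_left _ hj)
    · rw [hD, sup_right_comm]

theorem WReg.top {R : Type*} [CommRing R] (rs : List R) : WReg (⊤ : Ideal R) rs := by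
  induction rs with
  | nil => trivial
  | cons r rs ih => exact ⟨fun _ _ => trivial, by rwa [top_sup_eq]⟩

theorem dim_succ_le {R : Type*} [CommRing R] {K J : Ideal R} {r : R}
    (h : ∀ g, r * g ∈ K → g ∈ K) (hKJ : K ≤ J) (hr : r ∈ J) :
    ringKrullDim (R ⧸ J) + 1 ≤ ringKrullDim (R ⧸ K) := by
  refine ringKrullDim_succ_le_of_surjective (Ideal.Quotient.factor hKJ)
    (Ideal.Quotient.factor_surjective hKJ) (r := Ideal.Quotient.mk K r) ?_ ?_
  · rw [mem_nonZeroDivisors_iff_right]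
    intro x hx
    obtain ⟨y, rfl⟩ := Ideal.Quotient.mk_surjective x
    rw [← map_mul, Ideal.Quotient.eq_zero_iff_mem] at hx
    rw [Ideal.Quotient.eq_zero_iff_mem]
    exact h y (by rwa [mul_comm])
  · simpa [Ideal.Quotient.eq_zero_iff_mem] using hr

/-- One step: if `r` is regular modulo `I` and `I : f ⊆ m`, there is `y` with
`I : f ⊆ (I + r) : y ⊆ m`. -/
theorem exists_colon {R : Type*} [CommRing R] [IsNoetherianRing R] {m : Ideal R} (hm : m.IsPrime)
    {I : Ideal R} {r f : R} (hrm : r ∈ m) (hr : ∀ g, r * g ∈ I → g ∈ I)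
    (hf : ∀ g, f * g ∈ I → g ∈ m) :
    ∃ y, (∀ g, f * g ∈ I → y * g ∈ I) ∧ ∀ g, y * g ∈ I ⊔ Ideal.span {r} → g ∈ m := by
  classical
  by_contra hcon
  push Not at hcon
  let N : Ideal R :=
    { carrier := {y | ∀ g, f * g ∈ I → y * g ∈ I}
      add_mem' := fun {a b} ha hb g hg => by rw [add_mul]; exact I.add_mem (ha g hg) (hb g hg)
      zero_mem' := fun g _ => by simp
      smul_mem' := fun c x hx g hg => by
        rw [smul_eq_mul, mul_assoc]; exact I.mul_mem_left _ (hx g hg) }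
  have hfN : f ∈ N := fun g hg => hg
  have key : ∀ y ∈ N, ∃ s, s ∉ m ∧ s * y ∈ I ⊔ Ideal.span {r} * N := by
    intro y hy
    obtain ⟨s, hs, hsm⟩ := hcon y hy
    refine ⟨s, hsm, ?_⟩
    obtain ⟨i, hi, z, hz, e⟩ := Submodule.mem_sup.mp hs
    obtain ⟨w, rfl⟩ := Ideal.mem_span_singleton.mp hz
    have hw : w ∈ N := by
      intro g hg
      apply hr
      have : r * (w * g) = s * (y * g) - g * i := by
        linear_combination g * e
      rw [this]
      exact I.sub_mem (I.mul_mem_left _ (hy g hg)) (I.mul_mem_left _ hi)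
    rw [mul_comm s y, ← e]
    exact Submodule.add_mem_sup hi (Ideal.mul_mem_mul (Ideal.mem_span_singleton_self r) hw)
  choose! s hsm hs using key
  obtain ⟨S, hS⟩ := (isNoetherianRing_iff_ideal_fg R).mp inferInstance N
  have hSN : ∀ y ∈ S, y ∈ N := fun y hy => hS ▸ Ideal.subset_span hy
  set t := ∏ y ∈ S, s y with ht
  have htm : t ∉ m := by
    rw [ht, hm.prod_mem_iff]
    rintro ⟨y, hy, h⟩
    exact hsm y (hSN y hy) h
  have htN : ∀ y ∈ N, t * y ∈ I ⊔ Ideal.span {r} * N := by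
    have : N ≤ Submodule.comap (LinearMap.lsmul R R t) (I ⊔ Ideal.span {r} * N) := by
      conv_lhs => rw [← hS]
      refine Ideal.span_le.mpr fun y hy => ?_
      change t * y ∈ I ⊔ Ideal.span {r} * N
      rw [ht, ← Finset.prod_erase_mul S s hy, mul_assoc]
      exact Ideal.mul_mem_left _ _ (hs y (hSN y hy))
    exact this
  let M := Submodule.map I.mkQ N
  obtain ⟨p, hp, -, hpc, hp0⟩ :=
    LinearMap.exists_monic_and_natDegree_eq_and_coeff_mem_pow_and_aeval_eq_zero R
      (algebraMap R (Module.End R M) t) (Ideal.span {r}) (by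
        rintro _ ⟨⟨x, y, hy, rfl⟩, rfl⟩
        obtain ⟨i, hi, z, hz, e⟩ := Submodule.mem_sup.mp (htN y hy)
        obtain ⟨w, hw, rfl⟩ := Ideal.mem_span_singleton_mul.mp hz
        have : (algebraMap R (Module.End R M) t) ⟨I.mkQ y, ⟨y, hy, rfl⟩⟩
            = r • (⟨I.mkQ w, ⟨w, hw, rfl⟩⟩ : M) := by
          apply Subtype.ext
          change t • I.mkQ y = r • I.mkQ w
          rw [← map_smul, ← map_smul, ← sub_eq_zero, ← map_sub, ← LinearMap.mem_ker,
            Submodule.ker_mkQ]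
          have : t • y - r • w = i := by simp only [smul_eq_mul]; linear_combination -e
          rwa [this]
        rw [this]
        exact Submodule.smul_mem_smul (Ideal.mem_span_singleton_self r) trivial)
  rw [Polynomial.aeval_algebraMap_apply] at hp0
  have h0 : (p.eval t) * f ∈ I := by
    have := congrArg (fun φ : Module.End R M => ((φ ⟨I.mkQ f, ⟨f, hfN, rfl⟩⟩ : M) : R ⧸ I)) hp0
    change (Polynomial.aeval t p) • I.mkQ f = 0 at this
    rw [← map_smul, ← LinearMap.mem_ker, Submodule.ker_mkQ] at this
    simpa [Polynomial.aeval_def, Polynomial.eval₂_eq_eval_map] using this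
  have h1 : p.eval t ∈ m := hf _ (by rwa [mul_comm])
  rw [Polynomial.eval_eq_sum_range, Finset.sum_range_succ, hp.coeff_natDegree, one_mul] at h1
  have h2 : ∑ i ∈ Finset.range p.natDegree, p.coeff i * t ^ i ∈ m := by
    refine m.sum_mem fun i hi => m.mul_mem_right _ ?_
    have hle : Ideal.span {r} ^ (p.natDegree - i) ≤ m :=
      (Ideal.pow_le_self (by have := Finset.mem_range.mp hi; omega)).trans
        ((Ideal.span_singleton_le_iff_mem _).mpr hrm)
    exact hle (hpc i)
  exact htm (hm.mem_of_pow_mem _ ((m.add_mem_iff_right h2).mp h1))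

theorem length_le_dim {R : Type*} [CommRing R] [IsNoetherianRing R] {m : Ideal R} (hm : m.IsPrime)
    (rs : List R) {I K : Ideal R} {f : R} (hrs : ∀ r ∈ rs, r ∈ m) (h : WReg I rs)
    (hK : ∀ g, g ∈ K ↔ f * g ∈ I) (hKm : K ≤ m) :
    (rs.length : WithBot ℕ∞) ≤ ringKrullDim (R ⧸ K) := by
  induction rs generalizing I K f with
  | nil =>
    have : Nontrivial (R ⧸ K) :=
      Ideal.Quotient.nontrivial_iff.mpr (fun h => hm.ne_top (top_le_iff.mp (h ▸ hKm)))
    simpa using ringKrullDim_nonneg_of_nontrivial (R := R ⧸ K)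
  | cons r rs ih =>
    obtain ⟨h1, h2⟩ := h
    obtain ⟨y, hy1, hy2⟩ := exists_colon hm (hrs r (by simp)) h1 (fun g hg => hKm ((hK g).mpr hg))
    let J : Ideal R := Submodule.comap (LinearMap.lsmul R R y) (I ⊔ Ideal.span {r})
    have hJ : ∀ g, g ∈ J ↔ y * g ∈ I ⊔ Ideal.span {r} := fun g => Iff.rfl
    have := ih (fun r hr => hrs r (by simp [hr])) h2 hJ (fun g hg => hy2 g hg)
    have hd : ringKrullDim (R ⧸ J) + 1 ≤ ringKrullDim (R ⧸ K) := by
      refine dim_succ_le (r := r) ?_ ?_ ?_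
      · intro g hg
        rw [hK] at hg ⊢
        exact h1 _ (by convert hg using 1; ring)
      · intro g hg
        exact Ideal.mem_sup_left (hy1 g ((hK g).mp hg))
      · exact Ideal.mem_sup_right (Ideal.mul_mem_left _ _ (Ideal.mem_span_singleton_self r))
    refine le_trans ?_ hd
    rw [List.length_cons, Nat.cast_add, Nat.cast_one]
    gcongr


theorem sup_span_mem {R : Type*} [CommRing R] (J : Ideal R) (a x : R) :
    x ∈ J ⊔ Ideal.span {a} ↔ ∃ i ∈ J, ∃ h, x = i + a * h := by
  rw [Submodule.mem_sup]
  constructor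
  · rintro ⟨y, hy, z, hz, rfl⟩
    obtain ⟨w, rfl⟩ := Ideal.mem_span_singleton.mp hz
    exact ⟨y, hy, w, rfl⟩
  · rintro ⟨i, hi, h, rfl⟩
    exact ⟨i, hi, a * h, Ideal.mem_span_singleton.mpr ⟨h, rfl⟩, rfl⟩

theorem WReg.prod {R : Type*} [CommRing R] {ι : Type*} (rs : List R) (D : Ideal R) (x : ι → R)
    (S : Finset ι) (hnz : ∀ i ∈ S, ∀ g, x i * g ∈ D → g ∈ D)
    (h : ∀ i ∈ S, WReg (D ⊔ Ideal.span {x i}) rs) :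
    WReg (D ⊔ Ideal.span {∏ i ∈ S, x i}) rs := by
  classical
  induction S using Finset.induction_on with
  | empty => simpa using WReg.top rs
  | insert i S hi ih =>
    refine WReg.of_colon (f := x i) rs (C := D ⊔ Ideal.span {∏ i ∈ S, x i})
      (D := D ⊔ Ideal.span {x i}) ?_ ?_
      (ih (fun j hj => hnz j (by simp [hj])) (fun j hj => h j (by simp [hj]))) (h i (by simp))
    · intro g
      rw [sup_span_mem, sup_span_mem, Finset.prod_insert hi]
      constructor
      · rintro ⟨d, hd, h, rfl⟩
        exact ⟨x i * d, D.mul_mem_left _ hd, h, by ring⟩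
      · rintro ⟨d, hd, h, e⟩
        refine ⟨g - (∏ i ∈ S, x i) * h, hnz i (by simp) _ ?_, h, by ring⟩
        rwa [show x i * (g - (∏ i ∈ S, x i) * h) = d by rw [mul_sub, e]; ring]
    · rw [Finset.prod_insert hi, sup_assoc]
      congr 1
      refine (sup_eq_right.mpr ?_).symm
      rw [Ideal.span_singleton_le_span_singleton]
      exact ⟨_, rfl⟩

/-- The ladder ideal generated by `u_i ⋯ u_{p-1} v_0 ⋯ v_{i-1}` for `i ≤ p`. -/
def ladder {R : Type*} [CommRing R] (u v : ℕ → R) (p : ℕ) : Ideal R :=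
  Ideal.span ((fun i => (∏ j ∈ Finset.Ico i p, u j) * ∏ j ∈ Finset.range i, v j) '' {i | i ≤ p})

theorem ladder_zero {R : Type*} [CommRing R] (u v : ℕ → R) : ladder u v 0 = ⊤ := by
  rw [ladder, Ideal.eq_top_iff_one]
  exact Ideal.subset_span ⟨0, by simp⟩

theorem ladder_succ {R : Type*} [CommRing R] (u v : ℕ → R) (p : ℕ) :
    ladder u v (p + 1) =
      Ideal.span {u p} * ladder u v p ⊔ Ideal.span {∏ j ∈ Finset.range (p + 1), v j} := by
  have : {i | i ≤ p + 1} = {i | i ≤ p} ∪ {p + 1} := by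
    ext i; simp only [Set.mem_ofPred_eq, Set.mem_union, Set.mem_singleton_iff]; omega
  rw [ladder, this, Set.image_union, Ideal.span_union, Set.image_singleton]
  congr 1
  · rw [ladder, Ideal.span_mul_span', Set.singleton_mul, Set.image_image]
    congr 1
    refine Set.image_congr fun i hi => ?_
    rw [Finset.prod_Ico_succ_top hi]
    ring
  · simp

theorem WReg.ladder {R : Type*} [CommRing R] [IsDomain R] [DecompositionMonoid R] (rs : List R)
    (u v : ℕ → R) (p : ℕ)
    (hu : ∀ i < p, u i ≠ 0) (hrel : ∀ i < p, ∀ j < p, IsRelPrime (u i) (v j))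
    (h : ∀ i < p, ∀ j < p, WReg (Ideal.span {u i} ⊔ Ideal.span {v j}) rs) :
    WReg (ladder u v p) rs := by
  induction p with
  | zero => rw [ladder_zero]; exact WReg.top rs
  | succ p ih =>
    have ih := ih (fun i hi => hu i (by omega)) (fun i hi j hj => hrel i (by omega) j (by omega))
      (fun i hi j hj => h i (by omega) j (by omega))
    have hV : ∏ j ∈ Finset.range (p + 1), v j ∈ _root_.ladder u v p := by
      rw [Finset.prod_range_succ]
      exact Ideal.mul_mem_right _ _ (Ideal.subset_span ⟨p, by simp⟩)
    refine WReg.of_colon (f := u p) rs (C := _root_.ladder u v p)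
      (D := Ideal.span {u p} ⊔ Ideal.span {∏ j ∈ Finset.range (p + 1), v j}) ?_ ?_ ih ?_
    · intro g
      rw [ladder_succ, sup_span_mem]
      constructor
      · intro hg
        exact ⟨u p * g, Ideal.mul_mem_mul (Ideal.mem_span_singleton_self _) hg, 0, by ring⟩
      · rintro ⟨y, hy, b, e⟩
        obtain ⟨a, ha, rfl⟩ := Ideal.mem_span_singleton_mul.mp hy
        have hd : u p ∣ (∏ j ∈ Finset.range (p + 1), v j) * b :=
          ⟨g - a, by rw [mul_sub, e]; ring⟩
        have hr : IsRelPrime (u p) (∏ j ∈ Finset.range (p + 1), v j) :=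
          IsRelPrime.prod_right fun j hj => hrel p (by omega) j (Finset.mem_range.mp hj)
        obtain ⟨b', rfl⟩ := hr.dvd_of_dvd_mul_left hd
        have : g = a + b' * ∏ j ∈ Finset.range (p + 1), v j := by
          apply mul_left_cancel₀ (hu p (by omega))
          rw [e]; ring
        rw [this]
        exact Ideal.add_mem _ ha (Ideal.mul_mem_left _ _ hV)
    · rw [ladder_succ, sup_right_comm]
      congr 1
      exact (sup_eq_right.mpr Ideal.mul_le_left).symm
    · refine WReg.prod rs _ v _ ?_ ?_
      · intro j hj g hg
        rw [Ideal.mem_span_singleton] at hg ⊢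
        exact (hrel p (by omega) j (Finset.mem_range.mp hj)).dvd_of_dvd_mul_left hg
      · intro j hj
        exact h p (by omega) j (Finset.mem_range.mp hj)

theorem WReg.singleton_mul {R : Type*} [CommRing R] [IsDomain R] (rs : List R) (J : Ideal R)
    (c : R) (hc : c ≠ 0) (h1 : WReg J rs) (h2 : WReg (Ideal.span {c}) rs) :
    WReg (Ideal.span {c} * J) rs := by
  refine WReg.of_colon (f := c) rs ?_ ?_ h1 h2
  · intro g
    rw [Ideal.mem_span_singleton_mul]
    constructor
    · exact fun hg => ⟨g, hg, rfl⟩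
    · rintro ⟨z, hz, e⟩
      rwa [← mul_left_cancel₀ hc e]
  · exact (sup_eq_right.mpr Ideal.mul_le_left).symm

theorem WReg.map_equiv {R : Type*} [CommRing R] (e : R ≃+* R) (rs : List R) (I : Ideal R)
    (h : WReg I rs) : WReg (I.map (e : R →+* R)) (rs.map e) := by
  induction rs generalizing I with
  | nil => trivial
  | cons r rs ih =>
    obtain ⟨h1, h2⟩ := h
    refine ⟨?_, ?_⟩
    · intro g hg
      obtain ⟨y, hy, hye⟩ := (Ideal.mem_map_iff_of_surjective (e : R →+* R) e.surjective).mp hg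
      obtain ⟨g, rfl⟩ := e.surjective g
      have : y = r * g := e.injective (by simpa using hye)
      exact Ideal.mem_map_of_mem (e : R →+* R) (h1 g (this ▸ hy))
    · have := ih _ h2
      rwa [Ideal.map_sup, Ideal.map_span, Set.image_singleton] at this

open MvPolynomial in
theorem X_regular {k σ : Type*} [Field k] (S : Set σ) (j : σ) (hj : j ∉ S)
    (g : MvPolynomial σ k) (hg : X j * g ∈ Ideal.span (X '' S : Set (MvPolynomial σ k))) :
    g ∈ Ideal.span (X '' S : Set (MvPolynomial σ k)) := by
  classical
  rw [mem_ideal_span_X_image] at hg ⊢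
  intro m hm
  obtain ⟨i, hi, h⟩ := hg (Finsupp.single j 1 + m) (by
    rw [mem_support_iff, coeff_X_mul]; exact mem_support_iff.mp hm)
  refine ⟨i, hi, ?_⟩
  have : j ≠ i := fun h => hj (h ▸ hi)
  simpa [Finsupp.single_apply, this] using h

open MvPolynomial in
theorem WReg.vars {k σ : Type*} [Field k] (l : List σ) (S : Set σ) (hl : l.Nodup)
    (hS : ∀ j ∈ l, j ∉ S) :
    WReg (Ideal.span (X '' S : Set (MvPolynomial σ k))) (l.map X) := by
  induction l generalizing S with
  | nil => trivial
  | cons a l ih =>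
    refine ⟨X_regular S a (hS a (by simp)), ?_⟩
    rw [List.nodup_cons] at hl
    have := ih (S ∪ {a}) hl.2 (by
      intro j hj
      have h1 := hS j (by simp [hj])
      have h2 : j ≠ a := fun h => hl.1 (h ▸ hj)
      simp [h1, h2])
    rwa [Set.image_union, Ideal.span_union, Set.image_singleton] at this

open MvPolynomial in
theorem WReg.linear {k σ : Type*} [Field k] (β γ : σ → σ) (h1 : ∀ j, β (β j) = β j)
    (h2 : ∀ j, β (γ j) = β j) (h3 : ∀ j, γ (β j) = γ j) (l : List σ) (hl : l.Nodup)
    (hlβ : ∀ j ∈ l, β j ≠ j) (S : Set σ) (hS : ∀ j ∈ S, β j = j) :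
    WReg (Ideal.span ((fun j => (X (γ j) : MvPolynomial σ k)) '' S))
      (l.map fun j => (X j - X (β j) : MvPolynomial σ k)) := by
  classical
  have h4 : ∀ j, γ (γ j) = γ j := fun j => by rw [← h3 (γ j), h2, h3]
  let y : σ → MvPolynomial σ k := fun j => if β j = j then 0 else X j
  let f : MvPolynomial σ k →ₐ[k] MvPolynomial σ k :=
    aeval fun j => if β j = j then X (γ j) else X j - X (β j)
  let g : MvPolynomial σ k →ₐ[k] MvPolynomial σ k :=
    aeval fun j => y j - y (γ j) + X (β j)
  have fX : ∀ j, f (X j) = if β j = j then X (γ j) else X j - X (β j) := fun j => by simp [f]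
  have gX : ∀ j, g (X j) = y j - y (γ j) + X (β j) := fun j => by simp [g]
  have fy : ∀ j, f (y j) = X j - X (β j) := by
    intro j
    by_cases h : β j = j
    · simp [y, h]
    · simp [y, h, fX]
  have yβ : ∀ j, y (β j) = 0 := fun j => by simp [y, h1]
  let e : MvPolynomial σ k ≃ₐ[k] MvPolynomial σ k := AlgEquiv.ofAlgHom f g
    (by
      apply algHom_ext
      intro j
      simp only [AlgHom.comp_apply, gX, map_add, map_sub, fy, AlgHom.id_apply, h2]
      rw [fX, if_pos (h1 j), h3]
      ring)
    (by
      apply algHom_ext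
      intro j
      simp only [AlgHom.comp_apply, AlgHom.id_apply, fX]
      by_cases h : β j = j
      · rw [if_pos h, gX, h4, h2, h]; ring
      · rw [if_neg h, map_sub, gX, gX, yβ, h3, h1]
        simp only [y, if_neg h]
        ring)
  have eX : ∀ j, e (X j) = f (X j) := fun j => rfl
  have := WReg.map_equiv e.toRingEquiv _ _ (WReg.vars (k := k) l S hl
    (fun j hj hjS => hlβ j hj (hS j hjS)))
  rw [Ideal.map_span, Set.image_image, List.map_map] at this
  convert this using 1
  · congr 1
    refine Set.image_congr fun j hj => ?_
    change _ = e (X j)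
    rw [eX, fX, if_pos (hS j hj)]
  · refine List.map_congr_left fun j hj => ?_
    change _ = e (X j)
    rw [eX, fX, if_neg (hlβ j hj)]


/-- The variable `x_j`, indexed by natural numbers (`1` out of range). -/
noncomputable def xv (k : Type*) [Field k] (n : ℕ) (j : ℕ) : MvPolynomial (Fin n) k :=
  if h : j < n then MvPolynomial.X ⟨j, h⟩ else 1

theorem xv_of_lt (k : Type*) [Field k] {n j : ℕ} (h : j < n) :
    xv k n j = MvPolynomial.X ⟨j, h⟩ := dif_pos h

theorem spine_gen (k : Type*) [Field k] {n ℓ i : ℕ} (h : i + ℓ < n) :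
    (∏ v ∈ Finset.univ.filter (fun v : Fin n => i ≤ (v : ℕ) ∧ (v : ℕ) ≤ i + ℓ),
      (MvPolynomial.X v : MvPolynomial (Fin n) k)) = ∏ j ∈ Finset.Ico i (i + ℓ + 1), xv k n j := by
  refine Finset.prod_bij (fun v _ => v.val) ?_ ?_ ?_ ?_
  · intro v hv
    simp only [Finset.mem_filter, Finset.mem_univ, true_and] at hv
    rw [Finset.mem_Ico]; omega
  · intro a _ b _ hab
    exact Fin.ext hab
  · intro j hj
    rw [Finset.mem_Ico] at hj
    exact ⟨⟨j, by omega⟩, by simp; omega, rfl⟩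
  · intro v _
    rw [xv_of_lt k v.2]

theorem spine_eq (k : Type*) [Field k] {n ℓ p : ℕ} (hn : n = p + ℓ + 1) (hp : p ≤ ℓ + 1) :
    spinePathIdeal k n ℓ = Ideal.span {∏ j ∈ Finset.Ico p (ℓ + 1), xv k n j} *
      ladder (xv k n) (fun j => xv k n (ℓ + 1 + j)) p := by
  rw [spinePathIdeal, ladder, Ideal.span_mul_span', Set.singleton_mul, Set.image_image]
  have : {i : ℕ | i + ℓ < n} = {i | i ≤ p} := by
    ext i; simp only [Set.mem_ofPred_eq]; omega
  rw [this]
  congr 1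
  refine Set.image_congr fun i hi => ?_
  have hi : i ≤ p := hi
  rw [spine_gen k (by omega : i + ℓ < n), ← Finset.prod_Ico_consecutive _ hi (by omega),
    ← Finset.prod_Ico_consecutive (xv k n) hp (by omega : ℓ + 1 ≤ i + ℓ + 1),
    Finset.prod_Ico_eq_prod_range _ (ℓ + 1), show i + ℓ + 1 - (ℓ + 1) = i by omega]
  ring

theorem mem_spine (k : Type*) [Field k] {n ℓ i : ℕ} (h : i + ℓ < n) :
    ∏ j ∈ Finset.Ico i (i + ℓ + 1), xv k n j ∈ spinePathIdeal k n ℓ := by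
  rw [← spine_gen k h]
  exact Ideal.subset_span ⟨i, h, rfl⟩

theorem spine_le (k : Type*) [Field k] {n ℓ : ℕ} {J : Ideal (MvPolynomial (Fin n) k)}
    (h : ∀ i, i + ℓ < n → ∃ j, i ≤ j ∧ j ≤ i + ℓ ∧ xv k n j ∈ J) : spinePathIdeal k n ℓ ≤ J := by
  refine Ideal.span_le.mpr ?_
  rintro _ ⟨i, hi, rfl⟩
  obtain ⟨j, h1, h2, h3⟩ := h i hi
  have := spine_gen k (show i + ℓ < n from hi)
  simp only [SetLike.mem_coe]
  rw [this]
  exact J.mem_of_dvd (Finset.dvd_prod_of_mem _ (Finset.mem_Ico.mpr ⟨h1, by omega⟩)) h3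

theorem xv_ne_zero (k : Type*) [Field k] (n j : ℕ) : xv k n j ≠ 0 := by
  unfold xv; split
  · exact MvPolynomial.X_ne_zero _
  · exact one_ne_zero

theorem xv_relPrime (k : Type*) [Field k] (n : ℕ) {i j : ℕ} (h : i ≠ j) :
    IsRelPrime (xv k n i) (xv k n j) := by
  unfold xv
  split
  · split
    · rw [MvPolynomial.X_prime.irreducible.isRelPrime_iff_not_dvd, MvPolynomial.X_dvd_X]
      simpa using h
    · exact isRelPrime_one_right
  · exact isRelPrime_one_left

/-- Base point of the block of `j`. -/
def blockBase (n ℓ : ℕ) (hn : 0 < n) (j : Fin n) : Fin n :=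
  if (j : ℕ) ≤ ℓ then ⟨0, hn⟩ else ⟨n - 1, by omega⟩

/-- The regular sequence of differences `x_j - x_{base j}`. -/
noncomputable def diffSeq (k : Type*) [Field k] (n ℓ : ℕ) (hn : 0 < n) :
    List (MvPolynomial (Fin n) k) :=
  (Finset.univ.filter fun j => blockBase n ℓ hn j ≠ j).toList.map
    fun j => MvPolynomial.X j - MvPolynomial.X (blockBase n ℓ hn j)

theorem WReg.diff_one (k : Type*) [Field k] (n ℓ : ℕ) (hn : ℓ + 1 ≤ n) (a : ℕ) (ha : a ≤ ℓ) :
    WReg (Ideal.span {xv k n a}) (diffSeq k n ℓ (by omega)) := by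
  have := WReg.linear (k := k) (blockBase n ℓ (by omega))
    (fun j : Fin n => if (j : ℕ) ≤ ℓ then ⟨a, by omega⟩ else ⟨n - 1, by omega⟩)
    ?_ ?_ ?_ (Finset.univ.filter fun j => blockBase n ℓ (by omega) j ≠ j).toList
    (Finset.nodup_toList _) (by simp) {⟨0, by omega⟩} (by simp [blockBase])
  · rw [Set.image_singleton] at this
    rw [xv_of_lt k (by omega : a < n)]
    simpa [diffSeq] using this
  all_goals
    intro j
    have := j.2
    try simp only [Set.mem_insert_iff, Set.mem_singleton_iff]
    simp only [blockBase, Fin.ext_iff]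
    grind

theorem WReg.diff_two (k : Type*) [Field k] (n ℓ : ℕ) (hn : ℓ + 1 < n) (a : ℕ) (ha : a ≤ ℓ)
    (b : ℕ) (hb : ℓ < b) (hbn : b < n) :
    WReg (Ideal.span {xv k n a} ⊔ Ideal.span {xv k n b}) (diffSeq k n ℓ (by omega)) := by
  have := WReg.linear (k := k) (blockBase n ℓ (by omega))
    (fun j : Fin n => if (j : ℕ) ≤ ℓ then ⟨a, by omega⟩ else ⟨b, hbn⟩)
    ?_ ?_ ?_ (Finset.univ.filter fun j => blockBase n ℓ (by omega) j ≠ j).toList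
    (Finset.nodup_toList _) (by simp) {⟨0, by omega⟩, ⟨n - 1, by omega⟩} ?_
  · rw [Set.image_insert_eq, Set.image_singleton, Ideal.span_insert] at this
    rw [xv_of_lt k (by omega : a < n), xv_of_lt k hbn]
    simpa [diffSeq, show ¬ (n - 1 ≤ ℓ) by omega] using this
  all_goals
    intro j
    have := j.2
    try simp only [Set.mem_insert_iff, Set.mem_singleton_iff]
    simp only [blockBase, Fin.ext_iff]
    grind

theorem WReg.spine (k : Type*) [Field k] {n ℓ p : ℕ} (hn : n = p + ℓ + 1) (hp : p ≤ ℓ + 1) :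
    WReg (spinePathIdeal k n ℓ) (diffSeq k n ℓ (by omega)) := by
  rw [spine_eq k hn hp]
  refine WReg.singleton_mul _ _ _ (Finset.prod_ne_zero_iff.mpr fun j _ => xv_ne_zero k n j) ?_ ?_
  · refine WReg.ladder _ _ _ _ (fun i _ => xv_ne_zero k n i)
      (fun i hi j hj => xv_relPrime k n (by omega)) fun i hi j hj => ?_
    exact WReg.diff_two k n ℓ (by omega) i (by omega) _ (by omega) (by omega)
  · have := WReg.prod (diffSeq k n ℓ (by omega)) ⊥ (xv k n) (Finset.Ico p (ℓ + 1)) ?_ ?_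
    · rwa [bot_sup_eq] at this
    · intro j _ g hg
      simpa [xv_ne_zero] using hg
    · intro j hj
      rw [bot_sup_eq]
      exact WReg.diff_one k n ℓ (by omega) j (by have := Finset.mem_Ico.mp hj; omega)

theorem diffSeq_length_one (k : Type*) [Field k] (n ℓ : ℕ) (hn : n = ℓ + 1) :
    (diffSeq k n ℓ (by omega)).length = n - 1 := by
  rw [diffSeq, List.length_map, Finset.length_toList]
  have : (Finset.univ.filter fun j => blockBase n ℓ (by omega) j ≠ j)
      = Finset.univ.erase (⟨0, by omega⟩ : Fin n) := by
    ext j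
    have := j.2
    simp only [Finset.mem_filter, Finset.mem_univ, true_and, Finset.mem_erase, and_true]
    unfold blockBase
    rw [if_pos (by omega)]
    exact ne_comm
  rw [this, Finset.card_erase_of_mem (Finset.mem_univ _), Finset.card_univ, Fintype.card_fin]

theorem diffSeq_length_two (k : Type*) [Field k] (n ℓ : ℕ) (hn : ℓ + 1 < n) :
    (diffSeq k n ℓ (by omega)).length = n - 2 := by
  rw [diffSeq, List.length_map, Finset.length_toList]
  have : (Finset.univ.filter fun j => blockBase n ℓ (by omega) j ≠ j)
      = (Finset.univ.erase (⟨0, by omega⟩ : Fin n)).erase ⟨n - 1, by omega⟩ := by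
    ext j
    have := j.2
    simp only [Finset.mem_filter, Finset.mem_univ, true_and, Finset.mem_erase, and_true]
    unfold blockBase
    split <;> simp only [ne_eq, Fin.ext_iff] <;> omega
  rw [this, Finset.card_erase_of_mem, Finset.card_erase_of_mem (Finset.mem_univ _),
    Finset.card_univ, Fintype.card_fin]
  · omega
  · simp only [Finset.mem_erase, Finset.mem_univ, and_true, ne_eq, Fin.ext_iff]; omega

theorem irr_prime (k : Type*) [Field k] (n : ℕ) :
    (Ideal.span (Set.range (MvPolynomial.X : Fin n → MvPolynomial (Fin n) k))).IsPrime := by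
  have : Ideal.span (Set.range (MvPolynomial.X : Fin n → MvPolynomial (Fin n) k)) =
      RingHom.ker (MvPolynomial.constantCoeff : MvPolynomial (Fin n) k →+* k) := by
    ext f
    rw [← Set.image_univ, MvPolynomial.mem_ideal_span_X_image, RingHom.mem_ker,
      MvPolynomial.constantCoeff_eq]
    constructor
    · intro h
      by_contra h0
      obtain ⟨i, -, hi⟩ := h 0 (MvPolynomial.mem_support_iff.mpr h0)
      exact hi rfl
    · intro h m hm
      by_contra! hc
      have : m = 0 := by ext i; exact hc i trivial
      rw [this, MvPolynomial.mem_support_iff] at hm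
      exact hm h
  rw [this]
  exact RingHom.ker_isPrime _

theorem diffSeq_mem (k : Type*) [Field k] (n ℓ : ℕ) (hn : 0 < n) :
    ∀ r ∈ diffSeq k n ℓ hn, r ∈ Ideal.span
      (Set.range (MvPolynomial.X : Fin n → MvPolynomial (Fin n) k)) := by
  intro r hr
  obtain ⟨j, -, rfl⟩ := List.mem_map.mp hr
  exact Ideal.sub_mem _ (Ideal.subset_span ⟨_, rfl⟩) (Ideal.subset_span ⟨_, rfl⟩)

theorem xv_mem (k : Type*) [Field k] {n j : ℕ} (h : j < n) :
    xv k n j ∈ Ideal.span (Set.range (MvPolynomial.X : Fin n → MvPolynomial (Fin n) k)) := by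
  rw [xv_of_lt k h]; exact Ideal.subset_span ⟨_, rfl⟩

theorem isRegular_of_wReg {R : Type*} [CommRing R] {m I : Ideal R} (hm : m.IsPrime) (hI : I ≤ m)
    {rs : List R} (hrs : ∀ r ∈ rs, r ∈ m) (h : WReg I rs) :
    RingTheory.Sequence.IsRegular (R ⧸ I) rs := by
  refine ⟨(isWeaklyRegular_iff_wReg I rs).mpr h, fun htop => hm.ne_top ?_⟩
  have h1 : (Ideal.ofList rs • ⊤ : Submodule R (R ⧸ I)) ≤ Submodule.map I.mkQ m := by
    refine Submodule.smul_le.mpr fun r hr x _ => ?_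
    obtain ⟨y, rfl⟩ := Submodule.mkQ_surjective I x
    rw [← map_smul]
    exact Submodule.mem_map_of_mem (m.mul_mem_right _ (Ideal.span_le.mpr hrs hr))
  have h2 : I.mkQ 1 ∈ Submodule.map I.mkQ m := h1 (htop ▸ trivial)
  obtain ⟨y, hy, e⟩ := h2
  rw [← sub_eq_zero, ← map_sub, ← LinearMap.mem_ker, Submodule.ker_mkQ] at e
  rw [Ideal.eq_top_iff_one]
  have := m.sub_mem hy (hI e)
  simpa using this

theorem dim_poly (k : Type*) [Field k] (n : ℕ) :
    ringKrullDim (MvPolynomial (Fin n) k) = (n : WithBot ℕ∞) := by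
  rw [MvPolynomial.ringKrullDim_of_isNoetherianRing, ringKrullDim_eq_zero_of_field]
  simp

theorem le_of_add_one_le {x : WithBot ℕ∞} {N M : ℕ} (hM : M = N + 1)
    (h : x + 1 ≤ (M : WithBot ℕ∞)) : x ≤ N := by
  subst hM
  induction x with
  | bot => exact bot_le
  | coe x =>
    have h' : x + 1 ≤ ((N + 1 : ℕ) : ℕ∞) := by exact_mod_cast h
    have : x ≤ (N : ℕ∞) := by
      rw [Nat.cast_add, Nat.cast_one] at h'
      exact (ENat.add_le_add_iff_right ENat.one_ne_top).mp h'
    exact_mod_cast this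

theorem dim_le_one (k : Type*) [Field k] {n : ℕ} (hn : 1 ≤ n)
    {J : Ideal (MvPolynomial (Fin n) k)} {a : MvPolynomial (Fin n) k} (ha : a ∈ J) (h0 : a ≠ 0) :
    ringKrullDim (MvPolynomial (Fin n) k ⧸ J) ≤ ((n - 1 : ℕ) : WithBot ℕ∞) := by
  refine le_of_add_one_le (M := n) (by omega) ?_
  rw [← dim_poly k n]
  refine ringKrullDim_succ_le_of_surjective (Ideal.Quotient.mk J) Ideal.Quotient.mk_surjective
    (mem_nonZeroDivisors_of_ne_zero h0) ?_
  rwa [Ideal.Quotient.eq_zero_iff_mem]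

theorem dim_le_two (k : Type*) [Field k] {n : ℕ} (hn : 2 ≤ n)
    {J : Ideal (MvPolynomial (Fin n) k)} {a b : MvPolynomial (Fin n) k} (ha : a ∈ J) (hb : b ∈ J)
    (h0 : a ≠ 0) (hab : IsRelPrime a b) :
    ringKrullDim (MvPolynomial (Fin n) k ⧸ J) ≤ ((n - 2 : ℕ) : WithBot ℕ∞) := by
  refine le_of_add_one_le (M := n - 1) (by omega) ?_
  refine le_trans ?_ (dim_le_one k (by omega) (Ideal.mem_span_singleton_self a) h0)
  refine dim_succ_le (r := b) ?_ ((Ideal.span_singleton_le_iff_mem _).mpr ha) hb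
  intro g hg
  rw [Ideal.mem_span_singleton] at hg ⊢
  exact hab.dvd_of_dvd_mul_left hg

theorem depth_eq (k : Type*) [Field k] {n : ℕ} {I K : Ideal (MvPolynomial (Fin n) k)}
    {f : MvPolynomial (Fin n) k} (rs : List (MvPolynomial (Fin n) k)) (h : WReg I rs)
    (hrs : ∀ r ∈ rs, r ∈ Ideal.span
      (Set.range (MvPolynomial.X : Fin n → MvPolynomial (Fin n) k)))
    (hI : I ≤ Ideal.span (Set.range (MvPolynomial.X : Fin n → MvPolynomial (Fin n) k)))
    (hK : ∀ g, g ∈ K ↔ f * g ∈ I)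
    (hKm : K ≤ Ideal.span (Set.range (MvPolynomial.X : Fin n → MvPolynomial (Fin n) k)))
    (hdim : ringKrullDim (MvPolynomial (Fin n) k ⧸ K) ≤ (rs.length : WithBot ℕ∞)) :
    quotientDepth k I = rs.length := by
  have hub : ∀ d ∈ {d | ∃ rs : List (MvPolynomial (Fin n) k), rs.length = d ∧
    (∀ r ∈ rs, r ∈ Ideal.span
      (Set.range (MvPolynomial.X : Fin n → MvPolynomial (Fin n) k))) ∧
    RingTheory.Sequence.IsRegular (MvPolynomial (Fin n) k ⧸ I) rs}, d ≤ rs.length := by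
    rintro _ ⟨ss, rfl, hss, hreg⟩
    have := (length_le_dim (irr_prime k n) ss hss
      ((isWeaklyRegular_iff_wReg I ss).mp hreg.toIsWeaklyRegular) hK hKm).trans hdim
    exact_mod_cast this
  have hmem : rs.length ∈ {d | ∃ rs : List (MvPolynomial (Fin n) k), rs.length = d ∧
    (∀ r ∈ rs, r ∈ Ideal.span
      (Set.range (MvPolynomial.X : Fin n → MvPolynomial (Fin n) k))) ∧
    RingTheory.Sequence.IsRegular (MvPolynomial (Fin n) k ⧸ I) rs} :=
    ⟨rs, rfl, hrs, isRegular_of_wReg (irr_prime k n) hI hrs h⟩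
  exact le_antisymm (csSup_le ⟨_, hmem⟩ hub) (le_csSup ⟨_, hub⟩ hmem)

/-- Cohen-Macaulay case: a regular sequence of length at least the dimension. -/
theorem depth_eq_dim (k : Type*) [Field k] {n : ℕ} {I : Ideal (MvPolynomial (Fin n) k)}
    (rs : List (MvPolynomial (Fin n) k)) (h : WReg I rs)
    (hrs : ∀ r ∈ rs, r ∈ Ideal.span
      (Set.range (MvPolynomial.X : Fin n → MvPolynomial (Fin n) k)))
    (hI : I ≤ Ideal.span (Set.range (MvPolynomial.X : Fin n → MvPolynomial (Fin n) k)))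
    (hdim : ringKrullDim (MvPolynomial (Fin n) k ⧸ I) ≤ (rs.length : WithBot ℕ∞)) :
    (quotientDepth k I : WithBot ℕ∞) = ringKrullDim (MvPolynomial (Fin n) k ⧸ I) := by
  rw [depth_eq k (K := I) (f := 1) rs h hrs hI (by simp) hI hdim]
  exact le_antisymm (length_le_dim (K := I) (f := 1) (irr_prime k n) rs hrs h (by simp) hI) hdim

theorem spine_le_irr (k : Type*) [Field k] {n ℓ : ℕ} : spinePathIdeal k n ℓ ≤
    Ideal.span (Set.range (MvPolynomial.X : Fin n → MvPolynomial (Fin n) k)) :=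
  spine_le k fun i hi => ⟨i, le_rfl, by omega, xv_mem k (by omega)⟩

theorem prod_xv_relPrime (k : Type*) [Field k] (n : ℕ) {S T : Finset ℕ} (h : Disjoint S T) :
    IsRelPrime (∏ j ∈ S, xv k n j) (∏ j ∈ T, xv k n j) :=
  IsRelPrime.prod_left fun i hi => IsRelPrime.prod_right fun j hj =>
    xv_relPrime k n fun e => Finset.disjoint_left.mp h hi (e ▸ hj)

theorem le_dim_spine (k : Type*) [Field k] {n ℓ : ℕ} (h1 : ℓ + 1 < n) (h2 : n < 2 * ℓ + 2) :
    ((n - 1 : ℕ) : WithBot ℕ∞) ≤ ringKrullDim (MvPolynomial (Fin n) k ⧸ spinePathIdeal k n ℓ) := by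
  obtain ⟨N, rfl⟩ : ∃ N, n = N + 1 := ⟨n - 1, by omega⟩
  rw [Nat.add_sub_cancel, ← dim_poly k N]
  let a : Fin (N + 1) := ⟨ℓ, by omega⟩
  let φ : MvPolynomial (Fin (N + 1)) k →ₐ[k] MvPolynomial (Fin N) k :=
    MvPolynomial.aeval (a.insertNth 0 MvPolynomial.X)
  have hφa : φ (MvPolynomial.X a) = 0 := by simp [φ]
  have hφ : ∀ j, φ (MvPolynomial.X (a.succAbove j)) = MvPolynomial.X j := fun j => by simp [φ]
  have hsurj : Function.Surjective φ := by
    intro f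
    refine ⟨MvPolynomial.rename a.succAbove f, ?_⟩
    have : φ.comp (MvPolynomial.rename a.succAbove) = AlgHom.id k _ := by
      apply MvPolynomial.algHom_ext
      intro j
      simp [hφ]
    exact congrArg (fun ψ => ψ f) this
  have hker : spinePathIdeal k (N + 1) ℓ ≤ RingHom.ker (φ : _ →+* MvPolynomial (Fin N) k) := by
    refine spine_le k fun i hi => ⟨ℓ, by omega, by omega, ?_⟩
    rw [RingHom.mem_ker, xv_of_lt k (by omega)]
    exact hφa
  exact ringKrullDim_le_of_surjective
    (Ideal.Quotient.lift _ (φ : _ →+* MvPolynomial (Fin N) k) (fun a ha => RingHom.mem_ker.mp (hker ha)))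
    (Ideal.Quotient.lift_surjective_of_surjective _ _ hsurj)

theorem depth_middle (k : Type*) [Field k] {n ℓ : ℕ} (h1 : ℓ + 1 < n) (h2 : n < 2 * ℓ + 2) :
    quotientDepth k (spinePathIdeal k n ℓ) = n - 2 := by
  have hx0 : xv k n 0 = MvPolynomial.X ⟨0, by omega⟩ := xv_of_lt k _
  have hx1 : xv k n (ℓ + 1) = MvPolynomial.X ⟨ℓ + 1, h1⟩ := xv_of_lt k _
  let S : Set (Fin n) := {⟨0, by omega⟩, ⟨ℓ + 1, h1⟩}
  let K : Ideal (MvPolynomial (Fin n) k) := Ideal.span (MvPolynomial.X '' S)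
  have h0K : xv k n 0 ∈ K := hx0 ▸ Ideal.subset_span ⟨_, by simp [S], rfl⟩
  have h1K : xv k n (ℓ + 1) ∈ K := hx1 ▸ Ideal.subset_span ⟨_, by simp [S], rfl⟩
  have hIK : spinePathIdeal k n ℓ ≤ K := by
    refine spine_le k fun i hi => ?_
    by_cases h : i = 0
    · exact ⟨0, by omega, by omega, h0K⟩
    · exact ⟨ℓ + 1, by omega, by omega, h1K⟩
  let T : Finset ℕ := (Finset.range n).filter fun j => j ≠ 0 ∧ j ≠ ℓ + 1
  have hreg : ∀ U : Finset ℕ, U ⊆ T → ∀ g, (∏ j ∈ U, xv k n j) * g ∈ K → g ∈ K := by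
    intro U
    induction U using Finset.induction_on with
    | empty => intro _ g hg; simpa using hg
    | insert j U hj ih =>
      intro hU g hg
      rw [Finset.prod_insert hj, mul_assoc] at hg
      refine ih (fun x hx => hU (by simp [hx])) g ?_
      have hjT := hU (Finset.mem_insert_self j U)
      simp only [T, Finset.mem_filter, Finset.mem_range] at hjT
      rw [xv_of_lt k hjT.1] at hg
      exact X_regular S _ (by simp [S, Fin.ext_iff, hjT.2]) _ hg
  have hK : ∀ g, g ∈ K ↔ (∏ j ∈ T, xv k n j) * g ∈ spinePathIdeal k n ℓ := by
    intro g
    refine ⟨fun hg => ?_, fun hg => hreg T subset_rfl g (hIK hg)⟩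
    have hle : K ≤ Submodule.comap (LinearMap.lsmul _ _ (∏ j ∈ T, xv k n j))
        (spinePathIdeal k n ℓ) := by
      refine Ideal.span_le.mpr ?_
      have key : ∀ a i, i + ℓ < n → a ∉ T → Finset.Ico i (i + ℓ + 1) ⊆ insert a T →
          (∏ j ∈ T, xv k n j) * xv k n a ∈ spinePathIdeal k n ℓ := by
        intro a i hi ha hsub
        rw [mul_comm, ← Finset.prod_insert ha]
        exact Ideal.mem_of_dvd _ (Finset.prod_dvd_prod_of_subset _ _ _ hsub) (mem_spine k hi)
      rintro _ ⟨v, hv, rfl⟩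
      simp only [S, Set.mem_insert_iff, Set.mem_singleton_iff] at hv
      change (∏ j ∈ T, xv k n j) * MvPolynomial.X v ∈ spinePathIdeal k n ℓ
      rcases hv with rfl | rfl
      · rw [← hx0]
        refine key 0 0 (by omega) (by simp [T]) fun x hx => ?_
        rw [Finset.mem_Ico] at hx
        simp only [T, Finset.mem_insert, Finset.mem_filter, Finset.mem_range]
        omega
      · rw [← hx1]
        refine key (ℓ + 1) 1 (by omega) (by simp [T]) fun x hx => ?_
        rw [Finset.mem_Ico] at hx
        simp only [T, Finset.mem_insert, Finset.mem_filter, Finset.mem_range]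
        omega
    exact hle hg
  have hlen := diffSeq_length_two k n ℓ h1
  rw [← hlen]
  refine depth_eq k (K := K) (f := ∏ j ∈ T, xv k n j) _
    (WReg.spine k (p := n - ℓ - 1) (by omega) (by omega)) (diffSeq_mem k n ℓ (by omega))
    (spine_le_irr k) hK (Ideal.span_mono (Set.image_subset_range _ _)) ?_
  rw [hlen]
  exact dim_le_two k (by omega) h0K h1K (xv_ne_zero k n 0) (xv_relPrime k n (by omega))


/-- If `n = 2ℓ+2` or `n = ℓ+1`, then `R/P_ℓ(S_n)` is Cohen–Macaulay, i.e.
`depth (R/P_ℓ(S_n)) = dim (R/P_ℓ(S_n))`.  Moreover, for `ℓ+1 < n < 2ℓ+2`,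
`depth (R/P_ℓ(S_n)) = n-2` while `dim (R/P_ℓ(S_n)) = n-1`, so `R/P_ℓ(S_n)` is
not Cohen–Macaulay. -/
theorem spinePathIdeal_cohenMacaulay (k : Type*) [Field k] (n ℓ : ℕ)
    (hℓ : 1 ≤ ℓ) :
    ((n = 2 * ℓ + 2 ∨ n = ℓ + 1) →
      (quotientDepth k (spinePathIdeal k n ℓ) : WithBot (WithTop ℕ)) =
        ringKrullDim (MvPolynomial (Fin n) k ⧸ spinePathIdeal k n ℓ)) ∧
    (ℓ + 1 < n → n < 2 * ℓ + 2 →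
      quotientDepth k (spinePathIdeal k n ℓ) = n - 2 ∧
      ringKrullDim (MvPolynomial (Fin n) k ⧸ spinePathIdeal k n ℓ) =
        ((n - 1 : ℕ) : WithBot (WithTop ℕ))) := by
  refine ⟨?_, fun h1 h2 => ⟨depth_middle k h1 h2, ?_⟩⟩
  · rintro (h | h)
    · refine depth_eq_dim k _ (WReg.spine k (p := ℓ + 1) (by omega) le_rfl)
        (diffSeq_mem k n ℓ (by omega)) (spine_le_irr k) ?_
      rw [diffSeq_length_two k n ℓ (by omega)]
      refine dim_le_two k (by omega) (mem_spine k (by omega : 0 + ℓ < n))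
        (mem_spine k (by omega : (ℓ + 1) + ℓ < n))
        (Finset.prod_ne_zero_iff.mpr fun j _ => xv_ne_zero k n j) (prod_xv_relPrime k n ?_)
      rw [Finset.disjoint_left]
      intro x hx hx'
      rw [Finset.mem_Ico] at hx hx'
      omega
    · refine depth_eq_dim k _ (WReg.spine k (p := 0) (by omega) (by omega))
        (diffSeq_mem k n ℓ (by omega)) (spine_le_irr k) ?_
      rw [diffSeq_length_one k n ℓ (by omega)]
      exact dim_le_one k (by omega) (mem_spine k (by omega : 0 + ℓ < n))
        (Finset.prod_ne_zero_iff.mpr fun j _ => xv_ne_zero k n j)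
  · refine le_antisymm ?_ (le_dim_spine k h1 h2)
    exact dim_le_one k (by omega) (mem_spine k (by omega : 0 + ℓ < n))
      (Finset.prod_ne_zero_iff.mpr fun j _ => xv_ne_zero k n j)
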